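/- Product lemma: if there are successful resolutions 𝔄 ⇝ … ⇝ □ and 𝔅 ⇝ … ⇝ □, each with identity computed answer, then there is a successful resolution 𝔄 ⊗ 𝔅 ⇝^{[id]} □ with identity computed answer; moreover the resulting derivation is flat whenever both given derivations are flat. -/

import Mathlib

set_option maxHeartbeats 1000000

/-! ## Syntax of UCTT / HOHH -/

/-- Simple types of Church's theory: individuals, propositions, arrow types. -/
inductive Ty : Type
  | iota : Ty
  | o : Ty
  | arr : Ty → Ty → Ty
  deriving DecidableEq

/-- Free (logic) variables: carry an identifier, a level and a type. -/
structure Vr : Type where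
  name : ℕ
  lvl : ℕ
  ty : Ty
  deriving DecidableEq

/-- Constants: carry an identifier, a level and a type. -/
structure Cs : Type where
  name : ℕ
  lvl : ℕ
  ty : Ty
  deriving DecidableEq

/-- Simply typed λ-terms in (principal) normal form, with formulas (terms of
type `o`) represented by dedicated constructors for the logical constants
`⊤, ⊥, ∧, ∨, ⊃, Π (∀), Σ (∃)` in applied position.  Bound variables (`bvar`)
and free (logic) variables (`fvar`) are disjoint. -/
inductive Tm : Type
  | bvar : ℕ → Ty → Tm
  | fvar : Vr → Tm
  | cst : Cs → Tm
  | app : Tm → Tm → Tm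
  | lam : ℕ → Ty → Tm → Tm
  | top : Tm
  | bot : Tm
  | conj : Tm → Tm → Tm
  | disj : Tm → Tm → Tm
  | impl : Tm → Tm → Tm
  | all : ℕ → Ty → Tm → Tm
  | ex : ℕ → Ty → Tm → Tm
  deriving DecidableEq

namespace Tm

/-- Applying a map on free variables to a term.  Since bound and free
variables are disjoint, no capture can occur. -/
def subst (f : Vr → Tm) : Tm → Tm
  | bvar n a => bvar n a
  | fvar v => f v
  | cst c => cst c
  | app t u => app (subst f t) (subst f u)
  | lam n a t => lam n a (subst f t)
  | top => top
  | bot => bot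
  | conj t u => conj (subst f t) (subst f u)
  | disj t u => disj (subst f t) (subst f u)
  | impl t u => impl (subst f t) (subst f u)
  | all n a t => all n a (subst f t)
  | ex n a t => ex n a (subst f t)

/-- Instantiation `t[s/x]` of the bound variable `(x, a)` by the term `s`. -/
def inst (x : ℕ) (a : Ty) (s : Tm) : Tm → Tm
  | bvar n b => if n = x ∧ b = a then s else bvar n b
  | fvar v => fvar v
  | cst c => cst c
  | app t u => app (inst x a s t) (inst x a s u)
  | lam n b t => if n = x ∧ b = a then lam n b t else lam n b (inst x a s t)
  | top => top
  | bot => bot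
  | conj t u => conj (inst x a s t) (inst x a s u)
  | disj t u => disj (inst x a s t) (inst x a s u)
  | impl t u => impl (inst x a s t) (inst x a s u)
  | all n b t => if n = x ∧ b = a then all n b t else all n b (inst x a s t)
  | ex n b t => if n = x ∧ b = a then ex n b t else ex n b (inst x a s t)

/-- The level of a term: the maximum label of the constants and free
variables occurring in it. -/
def lvl : Tm → ℕ
  | bvar _ _ => 0
  | fvar v => v.lvl
  | cst c => c.lvl
  | app t u => max (lvl t) (lvl u)
  | lam _ _ t => lvl t
  | top => 0
  | bot => 0
  | conj t u => max (lvl t) (lvl u)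
  | disj t u => max (lvl t) (lvl u)
  | impl t u => max (lvl t) (lvl u)
  | all _ _ t => lvl t
  | ex _ _ t => lvl t

/-- The free variables of a term. -/
def fvars : Tm → Finset Vr
  | bvar _ _ => ∅
  | fvar v => {v}
  | cst _ => ∅
  | app t u => fvars t ∪ fvars u
  | lam _ _ t => fvars t
  | top => ∅
  | bot => ∅
  | conj t u => fvars t ∪ fvars u
  | disj t u => fvars t ∪ fvars u
  | impl t u => fvars t ∪ fvars u
  | all _ _ t => fvars t
  | ex _ _ t => fvars t

/-- The constants occurring in a term. -/
def csts : Tm → Finset Cs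
  | bvar _ _ => ∅
  | fvar _ => ∅
  | cst c => {c}
  | app t u => csts t ∪ csts u
  | lam _ _ t => csts t
  | top => ∅
  | bot => ∅
  | conj t u => csts t ∪ csts u
  | disj t u => csts t ∪ csts u
  | impl t u => csts t ∪ csts u
  | all _ _ t => csts t
  | ex _ _ t => csts t

/-- The canonical type of a term (meaningful on well-typed terms). -/
def tyOf : Tm → Ty
  | bvar _ a => a
  | fvar v => v.ty
  | cst c => c.ty
  | app t _ =>
      match tyOf t with
      | Ty.arr _ b => b
      | b => b
  | lam _ a t => Ty.arr a (tyOf t)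
  | _ => Ty.o

/-- Well-typedness of a term. -/
def wt : Tm → Prop
  | bvar _ _ => True
  | fvar _ => True
  | cst _ => True
  | app t u => wt t ∧ wt u ∧ ∃ b, tyOf t = Ty.arr (tyOf u) b
  | lam _ _ t => wt t
  | top => True
  | bot => True
  | conj t u => wt t ∧ wt u ∧ tyOf t = Ty.o ∧ tyOf u = Ty.o
  | disj t u => wt t ∧ wt u ∧ tyOf t = Ty.o ∧ tyOf u = Ty.o
  | impl t u => wt t ∧ wt u ∧ tyOf t = Ty.o ∧ tyOf u = Ty.o
  | all _ _ t => wt t ∧ tyOf t = Ty.o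
  | ex _ _ t => wt t ∧ tyOf t = Ty.o

/-- Positive terms: terms not containing `⊥`, `⊃` or `∀`. -/
def pos : Tm → Prop
  | bot => False
  | impl _ _ => False
  | all _ _ _ => False
  | app t u => pos t ∧ pos u
  | lam _ _ t => pos t
  | conj t u => pos t ∧ pos u
  | disj t u => pos t ∧ pos u
  | ex _ _ t => pos t
  | _ => True

/-- The head of an application spine. -/
def headTm : Tm → Tm
  | app t _ => headTm t
  | t => t

/-- Atomic formulas: terms (of type `o`) whose outermost constructor is not
a logical constant. -/
def isAtom : Tm → Prop
  | fvar _ => True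
  | cst _ => True
  | app _ _ => True
  | _ => False

/-- An atomic formula is rigid when its head symbol is a constant. -/
def rigid (t : Tm) : Prop := ∃ c : Cs, t.headTm = cst c

mutual
  /-- HOHH program formulas: `D ::= A_r | G ⊃ A_r | D ∧ D | ∀x.D`. -/
  inductive isProg : Tm → Prop
    | atom {t : Tm} : t.isAtom → t.rigid → isProg t
    | imp {g a : Tm} : isGoal g → a.isAtom → a.rigid → isProg (Tm.impl g a)
    | conj {d₁ d₂ : Tm} : isProg d₁ → isProg d₂ → isProg (Tm.conj d₁ d₂)
    | all {n : ℕ} {a : Ty} {d : Tm} : isProg d → isProg (Tm.all n a d)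

  /-- HOHH goal formulas:
  `G ::= ⊤ | A | G ∨ G | G ∧ G | ∃x.G | D ⊃ G | ∀x.G`. -/
  inductive isGoal : Tm → Prop
    | top : isGoal Tm.top
    | atom {t : Tm} : t.isAtom → isGoal t
    | conj {g₁ g₂ : Tm} : isGoal g₁ → isGoal g₂ → isGoal (Tm.conj g₁ g₂)
    | disj {g₁ g₂ : Tm} : isGoal g₁ → isGoal g₂ → isGoal (Tm.disj g₁ g₂)
    | ex {n : ℕ} {a : Ty} {g : Tm} : isGoal g → isGoal (Tm.ex n a g)
    | imp {d g : Tm} : isProg d → isGoal g → isGoal (Tm.impl d g)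
    | all {n : ℕ} {a : Ty} {g : Tm} : isGoal g → isGoal (Tm.all n a g)
end

/-- The elaboration of a program formula into its set of clauses. -/
def elabD : Tm → Set Tm
  | Tm.conj d₁ d₂ => elabD d₁ ∪ elabD d₂
  | Tm.all n a d => Tm.all n a '' elabD d
  | d => {d}

/-- Iterated universal quantification `∀x₁ … ∀xₙ. t`. -/
def alls : List (ℕ × Ty) → Tm → Tm
  | [], t => t
  | x :: xs, t => Tm.all x.1 x.2 (alls xs t)

/-- Simultaneous instantiation of a list of bound variables by a list of
terms (outermost binder first). -/
def instL : List (ℕ × Ty) → List Tm → Tm → Tm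
  | x :: xs, s :: ss, t => instL xs ss (inst x.1 x.2 s t)
  | _, _, t => t

end Tm

/-- The elaboration of a program (set of program formulas). -/
def elabProg (P : Finset Tm) : Set Tm := ⋃ D ∈ P, Tm.elabD D

/-! ## Substitutions -/

/-- Substitutions: finitely supported maps from free variables to terms. -/
structure Subst : Type where
  f : Vr → Tm
  fin : Set.Finite {v : Vr | f v ≠ Tm.fvar v}

namespace Subst

/-- The domain (support) of a substitution. -/
def dom (θ : Subst) : Set Vr := {v : Vr | θ.f v ≠ Tm.fvar v}

/-- The identity substitution. -/
protected def id : Subst :=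
  ⟨fun v => Tm.fvar v, by
    have : {v : Vr | Tm.fvar v ≠ Tm.fvar v} = ∅ := by ext v; simp
    rw [this]; exact Set.finite_empty⟩

/-- Composition of substitutions, in diagrammatic order. -/
def comp (σ τ : Subst) : Subst :=
  ⟨fun v => (σ.f v).subst τ.f, by
    apply Set.Finite.subset (σ.fin.union τ.fin)
    intro v hv
    simp only [Set.mem_setOf_eq] at hv
    by_contra h
    simp only [Set.mem_union, Set.mem_setOf_eq, not_or, not_not] at h
    apply hv
    rw [h.1]
    simp [Tm.subst, h.2]⟩

/-- Restriction of a substitution to a finite set of variables. -/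
def restrict (σ : Subst) (S : Finset Vr) : Subst :=
  ⟨fun v => if v ∈ S then σ.f v else Tm.fvar v, by
    apply Set.Finite.subset σ.fin
    intro v hv
    simp only [Set.mem_setOf_eq] at hv ⊢
    by_cases h : v ∈ S
    · simpa [h] using hv
    · simp [h] at hv⟩

/-- The substitution replacing the single variable `x` by the term `t`. -/
def single (x : Vr) (t : Tm) : Subst :=
  ⟨fun v => if v = x then t else Tm.fvar v, by
    apply Set.Finite.subset (Set.finite_singleton x)
    intro v hv
    simp only [Set.mem_setOf_eq] at hv
    by_cases h : v = x
    · simp [h]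
    · simp [h] at hv⟩

/-- Legal substitutions: the range consists of positive well-typed terms,
types are preserved, and levels are preserved. -/
def legal (θ : Subst) : Prop :=
  ∀ v : Vr, (θ.f v).pos ∧ (θ.f v).wt ∧ (θ.f v).tyOf = v.ty ∧ (θ.f v).lvl ≤ v.lvl

/-- Safe (idempotent) substitutions: the free variables of the range are
disjoint from the domain. -/
def safe (θ : Subst) : Prop :=
  ∀ v w : Vr, θ.f v ≠ Tm.fvar v → w ∈ (θ.f v).fvars → θ.f w = Tm.fvar w

/-- A substitution has level `≤ i` when every term in its range does. -/
def lvlLe (θ : Subst) (i : ℕ) : Prop :=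
  ∀ v ∈ θ.dom, (θ.f v).lvl ≤ i

end Subst

/-! ## States, state vectors and the resolution proof procedure RES(t) -/

/-- A state `⟨i; P; G⟩`: an index, a program and a goal. -/
structure St : Type where
  idx : ℕ
  prog : Finset Tm
  goal : Tm
  deriving DecidableEq

namespace St

/-- Applying a substitution to a state. -/
def sub (θ : Subst) (s : St) : St :=
  ⟨s.idx, s.prog.image (Tm.subst θ.f), Tm.subst θ.f s.goal⟩

/-- Free variables of a state. -/
def fvars (s : St) : Finset Vr := s.prog.sup Tm.fvars ∪ s.goal.fvars

/-- Constants of a state. -/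
def csts (s : St) : Finset Cs := s.prog.sup Tm.csts ∪ s.goal.csts

/-- Well-formedness of a state: the program consists of well-typed program
formulas of level at most the index, and the goal is a well-typed goal
formula of level at most the index. -/
def wf (s : St) : Prop :=
  (∀ D ∈ s.prog, Tm.isProg D ∧ D.wt ∧ D.tyOf = Ty.o ∧ D.lvl ≤ s.idx) ∧
    Tm.isGoal s.goal ∧ s.goal.wt ∧ s.goal.tyOf = Ty.o ∧ s.goal.lvl ≤ s.idx

end St

/-- Applying a substitution to a state vector. -/
def svSub (θ : Subst) (A : List St) : List St := A.map (St.sub θ)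

/-- Free variables of a state vector. -/
def svFvars (A : List St) : Finset Vr := A.foldr (fun s acc => s.fvars ∪ acc) ∅

/-- Constants of a state vector. -/
def svCsts (A : List St) : Finset Cs := A.foldr (fun s acc => s.csts ∪ acc) ∅

/-- Well-formedness of a state vector. -/
def svWf (A : List St) : Prop := ∀ s ∈ A, s.wf

/-- One resolution step of the RES(t) transition system, acting on a selected
state of the state vector.  The rules are: null, true, backchain, axiom,
or, and, instance, augment and generic. -/
inductive Step : List St → Subst → List St → Prop
  | null (A B : List St) (i : ℕ) (P : Finset Tm) :
      Step (A ++ St.mk i P Tm.top :: B) Subst.id (A ++ B)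
  | tru (A B : List St) (i : ℕ) (P : Finset Tm) (g : Tm) (θ : Subst) :
      g.isAtom → θ.legal → θ ≠ Subst.id → Tm.subst θ.f g = Tm.top →
      Step (A ++ St.mk i P g :: B) θ
        (svSub θ A ++ St.mk i (P.image (Tm.subst θ.f)) Tm.top :: svSub θ B)
  | backchain (A B : List St) (i : ℕ) (P : Finset Tm) (g : Tm)
      (xs : List (ℕ × Ty)) (G Ar : Tm) (ws : List Vr) (θ : Subst) :
      g.isAtom → g.rigid →
      Tm.alls xs (Tm.impl G Ar) ∈ elabProg P →
      List.Forall₂ (fun (w : Vr) (x : ℕ × Ty) => w.ty = x.2 ∧ w.lvl ≤ i) ws xs →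
      ws.Nodup →
      (∀ w ∈ ws, w ∉ svFvars (A ++ St.mk i P g :: B)) →
      θ.legal →
      Tm.subst θ.f g = Tm.subst θ.f (Tm.instL xs (ws.map Tm.fvar) Ar) →
      Step (A ++ St.mk i P g :: B) θ
        (svSub θ A ++
          St.mk i (P.image (Tm.subst θ.f))
            (Tm.subst θ.f (Tm.instL xs (ws.map Tm.fvar) G)) :: svSub θ B)
  | ax (A B : List St) (i : ℕ) (P : Finset Tm) (g : Tm)
      (xs : List (ℕ × Ty)) (Ar : Tm) (ws : List Vr) (θ : Subst) :
      g.isAtom → g.rigid →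
      Ar.isAtom →
      Tm.alls xs Ar ∈ elabProg P →
      List.Forall₂ (fun (w : Vr) (x : ℕ × Ty) => w.ty = x.2 ∧ w.lvl ≤ i) ws xs →
      ws.Nodup →
      (∀ w ∈ ws, w ∉ svFvars (A ++ St.mk i P g :: B)) →
      θ.legal →
      Tm.subst θ.f g = Tm.subst θ.f (Tm.instL xs (ws.map Tm.fvar) Ar) →
      Step (A ++ St.mk i P g :: B) θ (svSub θ A ++ svSub θ B)
  | orl (A B : List St) (i : ℕ) (P : Finset Tm) (g₁ g₂ : Tm) :
      Step (A ++ St.mk i P (Tm.disj g₁ g₂) :: B) Subst.id (A ++ St.mk i P g₁ :: B)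
  | orr (A B : List St) (i : ℕ) (P : Finset Tm) (g₁ g₂ : Tm) :
      Step (A ++ St.mk i P (Tm.disj g₁ g₂) :: B) Subst.id (A ++ St.mk i P g₂ :: B)
  | and (A B : List St) (i : ℕ) (P : Finset Tm) (g₁ g₂ : Tm) :
      Step (A ++ St.mk i P (Tm.conj g₁ g₂) :: B) Subst.id
        (A ++ St.mk i P g₁ :: St.mk i P g₂ :: B)
  | inst (A B : List St) (i : ℕ) (P : Finset Tm) (x : ℕ) (a : Ty) (g t : Tm) :
      t.pos → t.wt → t.tyOf = a → t.lvl ≤ i →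
      Step (A ++ St.mk i P (Tm.ex x a g) :: B) Subst.id
        (A ++ St.mk i P (Tm.inst x a t g) :: B)
  | augment (A B : List St) (i : ℕ) (P : Finset Tm) (d g : Tm) :
      Step (A ++ St.mk i P (Tm.impl d g) :: B) Subst.id
        (A ++ St.mk i (insert d P) g :: B)
  | generic (A B : List St) (i : ℕ) (P : Finset Tm) (x : ℕ) (a : Ty) (g : Tm)
      (c : Cs) :
      c.lvl = i + 1 → c.ty = a → c ∉ svCsts (A ++ St.mk i P (Tm.all x a g) :: B) →
      Step (A ++ St.mk i P (Tm.all x a g) :: B) Subst.id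
        (A ++ St.mk (i + 1) P (Tm.inst x a (Tm.cst c) g) :: B)

/-- One *flat* resolution step: as `Step`, but the true rule is forbidden and
in the backchain and axiom rules the substitution must be safe with domain
contained in the fresh renaming variables. -/
inductive FlatStep : List St → Subst → List St → Prop
  | null (A B : List St) (i : ℕ) (P : Finset Tm) :
      FlatStep (A ++ St.mk i P Tm.top :: B) Subst.id (A ++ B)
  | backchain (A B : List St) (i : ℕ) (P : Finset Tm) (g : Tm)
      (xs : List (ℕ × Ty)) (G Ar : Tm) (ws : List Vr) (θ : Subst) :
      g.isAtom → g.rigid →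
      Tm.alls xs (Tm.impl G Ar) ∈ elabProg P →
      List.Forall₂ (fun (w : Vr) (x : ℕ × Ty) => w.ty = x.2 ∧ w.lvl ≤ i) ws xs →
      ws.Nodup →
      (∀ w ∈ ws, w ∉ svFvars (A ++ St.mk i P g :: B)) →
      θ.legal → θ.safe → (∀ v : Vr, θ.f v ≠ Tm.fvar v → v ∈ ws) →
      Tm.subst θ.f g = Tm.subst θ.f (Tm.instL xs (ws.map Tm.fvar) Ar) →
      FlatStep (A ++ St.mk i P g :: B) θ
        (svSub θ A ++
          St.mk i (P.image (Tm.subst θ.f))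
            (Tm.subst θ.f (Tm.instL xs (ws.map Tm.fvar) G)) :: svSub θ B)
  | ax (A B : List St) (i : ℕ) (P : Finset Tm) (g : Tm)
      (xs : List (ℕ × Ty)) (Ar : Tm) (ws : List Vr) (θ : Subst) :
      g.isAtom → g.rigid →
      Ar.isAtom →
      Tm.alls xs Ar ∈ elabProg P →
      List.Forall₂ (fun (w : Vr) (x : ℕ × Ty) => w.ty = x.2 ∧ w.lvl ≤ i) ws xs →
      ws.Nodup →
      (∀ w ∈ ws, w ∉ svFvars (A ++ St.mk i P g :: B)) →
      θ.legal → θ.safe → (∀ v : Vr, θ.f v ≠ Tm.fvar v → v ∈ ws) →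
      Tm.subst θ.f g = Tm.subst θ.f (Tm.instL xs (ws.map Tm.fvar) Ar) →
      FlatStep (A ++ St.mk i P g :: B) θ (svSub θ A ++ svSub θ B)
  | orl (A B : List St) (i : ℕ) (P : Finset Tm) (g₁ g₂ : Tm) :
      FlatStep (A ++ St.mk i P (Tm.disj g₁ g₂) :: B) Subst.id (A ++ St.mk i P g₁ :: B)
  | orr (A B : List St) (i : ℕ) (P : Finset Tm) (g₁ g₂ : Tm) :
      FlatStep (A ++ St.mk i P (Tm.disj g₁ g₂) :: B) Subst.id (A ++ St.mk i P g₂ :: B)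
  | and (A B : List St) (i : ℕ) (P : Finset Tm) (g₁ g₂ : Tm) :
      FlatStep (A ++ St.mk i P (Tm.conj g₁ g₂) :: B) Subst.id
        (A ++ St.mk i P g₁ :: St.mk i P g₂ :: B)
  | inst (A B : List St) (i : ℕ) (P : Finset Tm) (x : ℕ) (a : Ty) (g t : Tm) :
      t.pos → t.wt → t.tyOf = a → t.lvl ≤ i →
      FlatStep (A ++ St.mk i P (Tm.ex x a g) :: B) Subst.id
        (A ++ St.mk i P (Tm.inst x a t g) :: B)
  | augment (A B : List St) (i : ℕ) (P : Finset Tm) (d g : Tm) :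
      FlatStep (A ++ St.mk i P (Tm.impl d g) :: B) Subst.id
        (A ++ St.mk i (insert d P) g :: B)
  | generic (A B : List St) (i : ℕ) (P : Finset Tm) (x : ℕ) (a : Ty) (g : Tm)
      (c : Cs) :
      c.lvl = i + 1 → c.ty = a → c ∉ svCsts (A ++ St.mk i P (Tm.all x a g) :: B) →
      FlatStep (A ++ St.mk i P (Tm.all x a g) :: B) Subst.id
        (A ++ St.mk (i + 1) P (Tm.inst x a (Tm.cst c) g) :: B)

/-- A resolution derivation of the indicated length, carrying the (full,
unrestricted) composition of the intervening substitutions. -/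
inductive Deriv : List St → Subst → List St → ℕ → Prop
  | refl (A : List St) : Deriv A Subst.id A 0
  | step {A B C : List St} {σ τ : Subst} {n : ℕ} :
      Step A σ B → Deriv B τ C n → Deriv A (σ.comp τ) C (n + 1)

/-- A flat derivation `𝔄 ⇝^{[id]} 𝔅` of the indicated length. -/
inductive FlatDeriv : List St → List St → ℕ → Prop
  | refl (A : List St) : FlatDeriv A A 0
  | step {A B C : List St} {σ : Subst} {n : ℕ} :
      FlatStep A σ B → FlatDeriv B C n → FlatDeriv A C (n + 1)

/-- `Resolves A θ C`: there is a resolution derivation from `A` to `C` whose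
computed answer (the composition of the intervening substitutions restricted
to the variables free in `A`) is `θ`. -/
def Resolves (A : List St) (θ : Subst) (C : List St) : Prop :=
  ∃ (n : ℕ) (σ : Subst), Deriv A σ C n ∧ θ = σ.restrict (svFvars A)

namespace Tm

/-- Renaming the free variables and the constants of a term. -/
def ren (p : Vr → Vr) (q : Cs → Cs) : Tm → Tm
  | bvar n a => bvar n a
  | fvar v => fvar (p v)
  | cst c => cst (q c)
  | app t u => app (ren p q t) (ren p q u)
  | lam n a t => lam n a (ren p q t)
  | top => top
  | bot => bot
  | conj t u => conj (ren p q t) (ren p q u)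
  | disj t u => disj (ren p q t) (ren p q u)
  | impl t u => impl (ren p q t) (ren p q u)
  | all n a t => all n a (ren p q t)
  | ex n a t => ex n a (ren p q t)

theorem subst_congr {f g : Vr → Tm} :
    ∀ {t : Tm}, (∀ v ∈ t.fvars, f v = g v) → t.subst f = t.subst g := by
  intro t
  induction t <;> intro h <;> simp_all [subst, fvars]

theorem subst_fvar (t : Tm) : t.subst fvar = t := by
  induction t <;> simp_all [subst]

theorem subst_eq_self {f : Vr → Tm} {t : Tm} (h : ∀ v ∈ t.fvars, f v = fvar v) :
    t.subst f = t := (subst_congr h).trans (subst_fvar t)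

theorem subst_ren {p p' : Vr → Vr} {q : Cs → Cs} {f g : Vr → Tm} :
    ∀ {t : Tm}, (∀ v ∈ t.fvars, g (p v) = (f v).ren p' q) →
      (t.ren p q).subst g = (t.subst f).ren p' q := by
  intro t
  induction t <;> intro h <;> simp_all [subst, fvars, ren]

theorem ren_eq_self {p : Vr → Vr} {q : Cs → Cs} :
    ∀ {t : Tm}, (∀ v ∈ t.fvars, p v = v) → (∀ c ∈ t.csts, q c = c) → t.ren p q = t := by
  intro t
  induction t <;> intro h h' <;> simp_all [csts, fvars, ren]

theorem ren_inst (p : Vr → Vr) (q : Cs → Cs) (x : ℕ) (a : Ty) (s t : Tm) :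
    (inst x a s t).ren p q = inst x a (s.ren p q) (t.ren p q) := by
  induction t <;> simp_all [inst, ren] <;> (try split_ifs) <;> simp_all [ren]

theorem ren_instL (p : Vr → Vr) (q : Cs → Cs) :
    ∀ (xs : List (ℕ × Ty)) (ws : List Vr) (t : Tm),
      (instL xs (ws.map fvar) t).ren p q = instL xs ((ws.map p).map fvar) (t.ren p q)
  | [], _, _ => by simp [instL]
  | _ :: _, [], _ => by simp [instL]
  | x :: xs, w :: ws, t => by
    simpa [instL, ren_inst, ren] using ren_instL p q xs ws (inst x.1 x.2 (fvar w) t)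

theorem ren_alls (p : Vr → Vr) (q : Cs → Cs) (xs : List (ℕ × Ty)) (t : Tm) :
    (alls xs t).ren p q = alls xs (t.ren p q) := by
  induction xs <;> simp_all [alls, ren]

theorem fvars_alls (xs : List (ℕ × Ty)) (t : Tm) : (alls xs t).fvars = t.fvars := by
  induction xs <;> simp_all [alls, fvars]

theorem fvars_inst_subset (x : ℕ) (a : Ty) (s t : Tm) :
    (inst x a s t).fvars ⊆ t.fvars ∪ s.fvars := by
  induction t <;> simp only [inst] <;> (try split_ifs) <;> simp only [fvars] at * <;> grind

theorem fvars_instL_subset :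
    ∀ (xs : List (ℕ × Ty)) (ws : List Vr) (t : Tm),
      (instL xs (ws.map fvar) t).fvars ⊆ t.fvars ∪ ws.toFinset
  | [], _, _ => by simp [instL]
  | _ :: _, [], _ => by simp [instL]
  | x :: xs, w :: ws, t => by
    have h₁ := fvars_instL_subset xs ws (inst x.1 x.2 (fvar w) t)
    have h₂ := fvars_inst_subset x.1 x.2 (fvar w) t
    simp only [instL, List.map_cons, List.toFinset_cons, fvars] at *
    grind

theorem fvars_ren (p : Vr → Vr) (q : Cs → Cs) (t : Tm) :
    (t.ren p q).fvars = t.fvars.image p := by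
  induction t <;> simp_all [fvars, ren, Finset.image_union]

theorem csts_ren (p : Vr → Vr) (q : Cs → Cs) (t : Tm) :
    (t.ren p q).csts = t.csts.image q := by
  induction t <;> simp_all [csts, ren, Finset.image_union]

theorem fvars_subset_of_mem_elabD {t d : Tm} (h : t ∈ elabD d) : t.fvars ⊆ d.fvars := by
  induction d generalizing t
  case conj d₁ d₂ h₁ h₂ =>
    rcases h with h | h
    · exact (h₁ h).trans Finset.subset_union_left
    · exact (h₂ h).trans Finset.subset_union_right
  case all n a d ih =>
    obtain ⟨t, ht, rfl⟩ := h
    have := ih ht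
    exact this
  all_goals
    simp only [elabD, Set.mem_singleton_iff] at h
    subst h
    exact Finset.Subset.rfl

theorem ren_mem_elabD (p : Vr → Vr) (q : Cs → Cs) {t d : Tm} (h : t ∈ elabD d) :
    t.ren p q ∈ elabD (d.ren p q) := by
  induction d generalizing t
  case conj d₁ d₂ h₁ h₂ =>
    rcases h with h | h
    · exact Or.inl (h₁ h)
    · exact Or.inr (h₂ h)
  case all n a d ih =>
    obtain ⟨t, ht, rfl⟩ := h
    exact ⟨_, ih ht, rfl⟩
  all_goals
    simp only [elabD, Set.mem_singleton_iff] at h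
    subst h
    simp [ren, elabD]

theorem isAtom.ren {p : Vr → Vr} {q : Cs → Cs} {t : Tm} (h : t.isAtom) :
    (t.ren p q).isAtom := by
  cases t <;> simp_all [isAtom, Tm.ren]

theorem headTm_ren (p : Vr → Vr) (q : Cs → Cs) (t : Tm) :
    (t.ren p q).headTm = t.headTm.ren p q := by
  induction t <;> simp_all [headTm, ren]

theorem rigid.ren {p : Vr → Vr} {q : Cs → Cs} {t : Tm} (h : t.rigid) : (t.ren p q).rigid := by
  obtain ⟨c, hc⟩ := h
  exact ⟨q c, by rw [headTm_ren, hc]; rfl⟩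

theorem pos.ren {p : Vr → Vr} {q : Cs → Cs} {t : Tm} (h : t.pos) : (t.ren p q).pos := by
  induction t <;> simp_all [pos, Tm.ren]

theorem eq_fvar_of_subst_eq_fvar {f : Vr → Tm} {t : Tm} {u : Vr} (h : t.subst f = fvar u) :
    ∃ v, t = fvar v := by
  cases t <;> simp_all [subst]

end Tm

/-- A renaming: permutations of the free variables and of the constants that
preserve levels and types. -/
structure Ren : Type where
  vr : Equiv.Perm Vr
  cs : Equiv.Perm Cs
  vr_lvl : ∀ v, (vr v).lvl = v.lvl
  vr_ty : ∀ v, (vr v).ty = v.ty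
  cs_lvl : ∀ c, (cs c).lvl = c.lvl
  cs_ty : ∀ c, (cs c).ty = c.ty

namespace Ren

/-- The identity renaming. -/
protected def one : Ren := ⟨1, 1, by simp, by simp, by simp, by simp⟩

/-- The action of a renaming on terms. -/
def tm (r : Ren) (t : Tm) : Tm := t.ren r.vr r.cs

theorem tm_one (t : Tm) : Ren.one.tm t = t :=
  Tm.ren_eq_self (fun _ _ => rfl) (fun _ _ => rfl)

theorem lvl_tm (r : Ren) (t : Tm) : (r.tm t).lvl = t.lvl := by
  unfold tm
  induction t <;> simp_all [Tm.lvl, Tm.ren, r.vr_lvl, r.cs_lvl]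

theorem tyOf_tm (r : Ren) (t : Tm) : (r.tm t).tyOf = t.tyOf := by
  unfold tm
  induction t <;> simp_all [Tm.tyOf, Tm.ren, r.vr_ty, r.cs_ty]

theorem wt_tm (r : Ren) {t : Tm} (h : t.wt) : (r.tm t).wt := by
  have hty := r.tyOf_tm
  unfold tm at *
  induction t <;> simp_all [Tm.wt, Tm.ren]

theorem pos_tm (r : Ren) {t : Tm} (h : t.pos) : (r.tm t).pos := h.ren

/-- The action of a renaming on states. -/
def st (r : Ren) (s : St) : St := ⟨s.idx, s.prog.image r.tm, r.tm s.goal⟩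

theorem st_one (s : St) : Ren.one.st s = s := by
  have : Ren.one.tm = id := funext tm_one
  simp [st, this]

theorem fvars_st (r : Ren) (s : St) : (r.st s).fvars = s.fvars.image r.vr := by
  ext v
  simp only [St.fvars, st, tm, Finset.mem_union, Finset.mem_sup, Finset.mem_image, Tm.fvars_ren]
  grind [Tm.fvars_ren]

theorem csts_st (r : Ren) (s : St) : (r.st s).csts = s.csts.image r.cs := by
  ext v
  simp only [St.csts, st, tm, Finset.mem_union, Finset.mem_sup, Finset.mem_image, Tm.csts_ren]
  grind [Tm.csts_ren]

/-- The action of a renaming on state vectors. -/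
def sv (r : Ren) (A : List St) : List St := A.map r.st

theorem sv_append (r : Ren) (A B : List St) : r.sv (A ++ B) = r.sv A ++ r.sv B :=
  List.map_append

theorem sv_one (A : List St) : Ren.one.sv A = A := by
  have : Ren.one.st = id := funext st_one
  simp [sv, this]

end Ren

theorem mem_svFvars {A : List St} {v : Vr} : v ∈ svFvars A ↔ ∃ s ∈ A, v ∈ s.fvars := by
  induction A <;> simp_all [svFvars]

theorem mem_svCsts {A : List St} {c : Cs} : c ∈ svCsts A ↔ ∃ s ∈ A, c ∈ s.csts := by
  induction A <;> simp_all [svCsts]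

theorem mem_svFvars_append {A B : List St} {v : Vr} :
    v ∈ svFvars (A ++ B) ↔ v ∈ svFvars A ∨ v ∈ svFvars B := by
  simp [mem_svFvars, or_and_right, exists_or]

theorem mem_svCsts_append {A B : List St} {c : Cs} :
    c ∈ svCsts (A ++ B) ↔ c ∈ svCsts A ∨ c ∈ svCsts B := by
  simp [mem_svCsts, or_and_right, exists_or]

theorem St.mem_fvars_of_prog {s : St} {D : Tm} {v : Vr} (hD : D ∈ s.prog) (hv : v ∈ D.fvars) :
    v ∈ s.fvars :=
  Finset.mem_union_left _ (Finset.mem_sup.2 ⟨D, hD, hv⟩)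

theorem St.mem_fvars_of_goal {s : St} {v : Vr} (hv : v ∈ s.goal.fvars) : v ∈ s.fvars :=
  Finset.mem_union_right _ hv

theorem St.mem_csts_of_prog {s : St} {D : Tm} {c : Cs} (hD : D ∈ s.prog) (hc : c ∈ D.csts) :
    c ∈ s.csts :=
  Finset.mem_union_left _ (Finset.mem_sup.2 ⟨D, hD, hc⟩)

theorem St.mem_csts_of_goal {s : St} {c : Cs} (hc : c ∈ s.goal.csts) : c ∈ s.csts :=
  Finset.mem_union_right _ hc

theorem St.fvars_subset_of_mem_elabProg {s : St} {t : Tm} (h : t ∈ elabProg s.prog) :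
    t.fvars ⊆ s.fvars := by
  simp only [elabProg, Set.mem_iUnion] at h
  obtain ⟨D, hD, h⟩ := h
  exact fun v hv => St.mem_fvars_of_prog hD (Tm.fvars_subset_of_mem_elabD h hv)

theorem Ren.tm_mem_elabProg (r : Ren) {P : Finset Tm} {t : Tm} (h : t ∈ elabProg P) :
    r.tm t ∈ elabProg (P.image r.tm) := by
  simp only [elabProg, Set.mem_iUnion] at h ⊢
  obtain ⟨D, hD, h⟩ := h
  exact ⟨r.tm D, Finset.mem_image_of_mem _ hD, Tm.ren_mem_elabD _ _ h⟩

theorem Ren.mem_svFvars_sv (r : Ren) {A : List St} {v : Vr} :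
    v ∈ svFvars (r.sv A) ↔ ∃ u ∈ svFvars A, r.vr u = v := by
  simp only [mem_svFvars, Ren.sv, List.mem_map]
  grind [Ren.fvars_st]

theorem Ren.mem_svCsts_sv (r : Ren) {A : List St} {c : Cs} :
    c ∈ svCsts (r.sv A) ↔ ∃ d ∈ svCsts A, r.cs d = c := by
  simp only [mem_svCsts, Ren.sv, List.mem_map]
  grind [Ren.csts_st]

theorem Ren.st_eq_self (r : Ren) {s : St} (hv : ∀ v ∈ s.fvars, r.vr v = v)
    (hc : ∀ c ∈ s.csts, r.cs c = c) : r.st s = s := by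
  obtain ⟨i, P, g⟩ := s
  have hP : P.image r.tm = P := by
    refine (Finset.image_congr (g := id) fun D hD => ?_).trans Finset.image_id
    exact Tm.ren_eq_self (fun v h => hv v (St.mem_fvars_of_prog hD h))
      (fun c h => hc c (St.mem_csts_of_prog hD h))
  have hg : r.tm g = g :=
    Tm.ren_eq_self (fun v h => hv v (St.mem_fvars_of_goal h))
      (fun c h => hc c (St.mem_csts_of_goal h))
  simp [Ren.st, hP, hg]

theorem Ren.sv_eq_self (r : Ren) {A : List St} (hv : ∀ v ∈ svFvars A, r.vr v = v)
    (hc : ∀ c ∈ svCsts A, r.cs c = c) : r.sv A = A := by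
  refine (List.map_congr_left (g := id) fun s hs => ?_).trans (List.map_id A)
  exact r.st_eq_self (fun v h => hv v (mem_svFvars.2 ⟨s, hs, h⟩))
    (fun c h => hc c (mem_svCsts.2 ⟨s, hs, h⟩))

theorem St.sub_ren {r r' : Ren} (hcs : r.cs = r'.cs) {θ θ' : Subst} {s : St}
    (h : ∀ v ∈ s.fvars, θ'.f (r.vr v) = r'.tm (θ.f v)) :
    (r.st s).sub θ' = r'.st (s.sub θ) := by
  have key : ∀ t : Tm, t.fvars ⊆ s.fvars → (r.tm t).subst θ'.f = r'.tm (t.subst θ.f) := by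
    intro t ht
    unfold Ren.tm at *
    rw [hcs]
    exact Tm.subst_ren fun v hv => h v (ht hv)
  have hg := key s.goal fun v => St.mem_fvars_of_goal
  have hP : (s.prog.image r.tm).image (Tm.subst θ'.f) =
      (s.prog.image (Tm.subst θ.f)).image r'.tm := by
    rw [Finset.image_image, Finset.image_image]
    exact Finset.image_congr fun D hD => key D fun v => St.mem_fvars_of_prog hD
  simp [St.sub, Ren.st, hg, hP]

theorem svSub_ren {r r' : Ren} (hcs : r.cs = r'.cs) {θ θ' : Subst} {A : List St}
    (h : ∀ v ∈ svFvars A, θ'.f (r.vr v) = r'.tm (θ.f v)) :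
    svSub θ' (r.sv A) = r'.sv (svSub θ A) := by
  simp only [svSub, Ren.sv, List.map_map]
  exact List.map_congr_left fun s hs =>
    St.sub_ren hcs fun v hv => h v (mem_svFvars.2 ⟨s, hs, hv⟩)

theorem svSub_append (θ : Subst) (A B : List St) : svSub θ (A ++ B) = svSub θ A ++ svSub θ B :=
  List.map_append

theorem svSub_eq_self {θ : Subst} {A : List St} (h : ∀ v ∈ svFvars A, θ.f v = Tm.fvar v) :
    svSub θ A = A := by
  refine (List.map_congr_left (g := id) fun s hs => ?_).trans (List.map_id A)
  obtain ⟨i, P, g⟩ := s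
  have key : ∀ t : Tm, t.fvars ⊆ (St.mk i P g).fvars → t.subst θ.f = t := fun t ht =>
    Tm.subst_eq_self fun v hv => h v (mem_svFvars.2 ⟨_, hs, ht hv⟩)
  have hP : P.image (Tm.subst θ.f) = P :=
    (Finset.image_congr (g := id) fun D hD =>
      key D fun v => St.mem_fvars_of_prog (s := St.mk i P g) hD).trans Finset.image_id
  have hg : g.subst θ.f = g := key g fun v => St.mem_fvars_of_goal (s := St.mk i P g)
  simp [St.sub, hP, hg]

theorem svSub_id (A : List St) : svSub Subst.id A = A := svSub_eq_self fun _ _ => rfl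

namespace Subst

theorem ext_f {σ τ : Subst} (h : ∀ v, σ.f v = τ.f v) : σ = τ := by
  obtain ⟨f, hf⟩ := σ
  obtain ⟨g, hg⟩ := τ
  obtain rfl : f = g := funext h
  rfl

theorem comp_assoc (ρ σ τ : Subst) : (ρ.comp σ).comp τ = ρ.comp (σ.comp τ) := by
  refine ext_f fun v => ?_
  simp only [comp]
  induction ρ.f v <;> simp_all [Tm.subst]

theorem id_comp (σ : Subst) : Subst.id.comp σ = σ := rfl

theorem legal_id : Subst.id.legal := fun v => by
  simp [Subst.id, Tm.pos, Tm.wt, Tm.tyOf, Tm.lvl]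

/-- The conjugate of a substitution by a renaming. -/
def conj (r : Ren) (θ : Subst) : Subst :=
  ⟨fun v => r.tm (θ.f (r.vr.symm v)), by
    refine (θ.fin.image r.vr).subset fun v hv => ⟨r.vr.symm v, fun h => hv ?_, by simp⟩
    simp [h, Ren.tm, Tm.ren]⟩

theorem conj_apply (r : Ren) (θ : Subst) (v : Vr) : (conj r θ).f (r.vr v) = r.tm (θ.f v) := by
  simp [conj]

theorem conj_id (r : Ren) : conj r Subst.id = Subst.id :=
  ext_f fun v => by simp [conj, Subst.id, Ren.tm, Tm.ren]

theorem conj_comp (r : Ren) (σ τ : Subst) : conj r (σ.comp τ) = (conj r σ).comp (conj r τ) :=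
  ext_f fun _ => (Tm.subst_ren fun u _ => conj_apply r τ u).symm

theorem legal.conj {θ : Subst} (h : θ.legal) (r : Ren) : (conj r θ).legal := fun v => by
  obtain ⟨h₁, h₂, h₃, h₄⟩ := h (r.vr.symm v)
  have hv : r.vr (r.vr.symm v) = v := by simp
  refine ⟨r.pos_tm h₁, r.wt_tm h₂, ?_, ?_⟩
  · simpa [Subst.conj, r.tyOf_tm, h₃, hv] using (r.vr_ty (r.vr.symm v)).symm
  · have := r.vr_lvl (r.vr.symm v)
    rw [hv] at this
    simpa [Subst.conj, r.lvl_tm, this] using h₄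

theorem conj_ne {r : Ren} {θ : Subst} {v : Vr} (h : (conj r θ).f v ≠ Tm.fvar v) :
    θ.f (r.vr.symm v) ≠ Tm.fvar (r.vr.symm v) := fun h' => h (by simp [conj, h', Ren.tm, Tm.ren])

theorem safe.conj {θ : Subst} (h : θ.safe) (r : Ren) : (conj r θ).safe := fun v w hv hw => by
  simp only [Subst.conj, Ren.tm, Tm.fvars_ren, Finset.mem_image] at hw
  obtain ⟨u, hu, rfl⟩ := hw
  rw [conj_apply, h _ u (conj_ne hv) hu]
  rfl

end Subst

/-- The local part of a resolution step: the selected state, the fresh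
variables and constants, the substitution and the states replacing the
selected one.  For `flat = True` only the flat rules are allowed. -/
inductive Loc (flat : Prop) : St → List Vr → List Cs → Subst → List St → Prop
  | null (i : ℕ) (P : Finset Tm) : Loc flat ⟨i, P, Tm.top⟩ [] [] Subst.id []
  | tru (i : ℕ) (P : Finset Tm) (g : Tm) (θ : Subst) :
      ¬ flat → g.isAtom → θ.legal → θ ≠ Subst.id → Tm.subst θ.f g = Tm.top →
      Loc flat ⟨i, P, g⟩ [] [] θ [⟨i, P.image (Tm.subst θ.f), Tm.top⟩]
  | backchain (i : ℕ) (P : Finset Tm) (g : Tm) (xs : List (ℕ × Ty)) (G Ar : Tm)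
      (ws : List Vr) (θ : Subst) :
      g.isAtom → g.rigid → Tm.alls xs (Tm.impl G Ar) ∈ elabProg P →
      List.Forall₂ (fun (w : Vr) (x : ℕ × Ty) => w.ty = x.2 ∧ w.lvl ≤ i) ws xs →
      ws.Nodup → θ.legal →
      (flat → θ.safe ∧ ∀ v : Vr, θ.f v ≠ Tm.fvar v → v ∈ ws) →
      Tm.subst θ.f g = Tm.subst θ.f (Tm.instL xs (ws.map Tm.fvar) Ar) →
      Loc flat ⟨i, P, g⟩ ws [] θ
        [⟨i, P.image (Tm.subst θ.f), Tm.subst θ.f (Tm.instL xs (ws.map Tm.fvar) G)⟩]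
  | ax (i : ℕ) (P : Finset Tm) (g : Tm) (xs : List (ℕ × Ty)) (Ar : Tm)
      (ws : List Vr) (θ : Subst) :
      g.isAtom → g.rigid → Ar.isAtom → Tm.alls xs Ar ∈ elabProg P →
      List.Forall₂ (fun (w : Vr) (x : ℕ × Ty) => w.ty = x.2 ∧ w.lvl ≤ i) ws xs →
      ws.Nodup → θ.legal →
      (flat → θ.safe ∧ ∀ v : Vr, θ.f v ≠ Tm.fvar v → v ∈ ws) →
      Tm.subst θ.f g = Tm.subst θ.f (Tm.instL xs (ws.map Tm.fvar) Ar) →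
      Loc flat ⟨i, P, g⟩ ws [] θ []
  | orl (i : ℕ) (P : Finset Tm) (g₁ g₂ : Tm) :
      Loc flat ⟨i, P, Tm.disj g₁ g₂⟩ [] [] Subst.id [⟨i, P, g₁⟩]
  | orr (i : ℕ) (P : Finset Tm) (g₁ g₂ : Tm) :
      Loc flat ⟨i, P, Tm.disj g₁ g₂⟩ [] [] Subst.id [⟨i, P, g₂⟩]
  | and (i : ℕ) (P : Finset Tm) (g₁ g₂ : Tm) :
      Loc flat ⟨i, P, Tm.conj g₁ g₂⟩ [] [] Subst.id [⟨i, P, g₁⟩, ⟨i, P, g₂⟩]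
  | inst (i : ℕ) (P : Finset Tm) (x : ℕ) (a : Ty) (g t : Tm) :
      t.pos → t.wt → t.tyOf = a → t.lvl ≤ i →
      Loc flat ⟨i, P, Tm.ex x a g⟩ [] [] Subst.id [⟨i, P, Tm.inst x a t g⟩]
  | augment (i : ℕ) (P : Finset Tm) (d g : Tm) :
      Loc flat ⟨i, P, Tm.impl d g⟩ [] [] Subst.id [⟨i, insert d P, g⟩]
  | generic (i : ℕ) (P : Finset Tm) (x : ℕ) (a : Ty) (g : Tm) (c : Cs) :
      c.lvl = i + 1 → c.ty = a →
      Loc flat ⟨i, P, Tm.all x a g⟩ [] [c] Subst.id [⟨i + 1, P, Tm.inst x a (Tm.cst c) g⟩]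

namespace Loc

variable {flat : Prop} {s : St} {ws : List Vr} {cs : List Cs} {θ : Subst} {l : List St}

theorem legal (h : Loc flat s ws cs θ l) : θ.legal := by
  cases h <;> first | assumption | exact Subst.legal_id

theorem safe_and_dom (h : Loc flat s ws cs θ l) (hf : flat) :
    θ.safe ∧ ∀ v : Vr, θ.f v ≠ Tm.fvar v → v ∈ ws := by
  cases h
  case tru => contradiction
  case backchain => tauto
  case ax => tauto
  all_goals simp [Subst.safe, Subst.id]

/-- Local steps are preserved when the source is renamed by `r`, the target
by `r'`, and the substitution is changed to one that agrees with the induced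
one on the relevant variables. -/
theorem twist (h : Loc flat s ws cs θ l) {r r' : Ren} (hcs : r.cs = r'.cs) {θ' : Subst}
    (hag : ∀ v, v ∈ s.fvars ∨ v ∈ ws → θ'.f (r.vr v) = r'.tm (θ.f v))
    (hleg : θ'.legal) (hid : θ = Subst.id → r = r' ∧ θ' = Subst.id)
    (hflat : flat → θ'.safe ∧ ∀ v : Vr, θ'.f v ≠ Tm.fvar v → v ∈ ws.map r.vr) :
    Loc flat (r.st s) (ws.map r.vr) (cs.map r.cs) θ' (r'.sv l) := by
  have key : ∀ t : Tm, (∀ v ∈ t.fvars, v ∈ s.fvars ∨ v ∈ ws) →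
      (r.tm t).subst θ'.f = r'.tm (t.subst θ.f) := by
    intro t ht
    unfold Ren.tm at *
    rw [hcs]
    exact Tm.subst_ren fun v hv => hag v (ht v hv)
  have hprog : (s.prog.image r.tm).image (Tm.subst θ'.f) =
      (s.prog.image (Tm.subst θ.f)).image r'.tm := by
    rw [Finset.image_image, Finset.image_image]
    exact Finset.image_congr fun D hD => key D fun v hv => Or.inl (St.mem_fvars_of_prog hD hv)
  have hgoal := key s.goal fun v hv => Or.inl (St.mem_fvars_of_goal hv)
  have hws : ∀ {i : ℕ} {xs : List (ℕ × Ty)},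
      List.Forall₂ (fun (w : Vr) (x : ℕ × Ty) => w.ty = x.2 ∧ w.lvl ≤ i) ws xs →
      List.Forall₂ (fun (w : Vr) (x : ℕ × Ty) => w.ty = x.2 ∧ w.lvl ≤ i) (ws.map r.vr) xs := by
    intro i xs hw
    rw [List.forall₂_map_left_iff]
    simpa only [r.vr_ty, r.vr_lvl] using hw
  have hinst : ∀ (xs : List (ℕ × Ty)) (t : Tm), t.fvars ⊆ s.fvars →
      (Tm.instL xs ((ws.map r.vr).map Tm.fvar) (r.tm t)).subst θ'.f =
        r'.tm ((Tm.instL xs (ws.map Tm.fvar) t).subst θ.f) := by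
    intro xs t ht
    rw [← key, Ren.tm, Ren.tm, Tm.ren_instL]
    intro v hv
    have := Tm.fvars_instL_subset xs ws t hv
    rw [Finset.mem_union, List.mem_toFinset] at this
    exact this.imp_left fun h => ht h
  cases h
  case tru i P g hnf hg hl hne htop =>
    simp only at hprog hgoal
    have hgt : (r.tm g).subst θ'.f = Tm.top := by rw [hgoal, htop]; rfl
    have := Loc.tru (flat := flat) i (P.image r.tm) (r.tm g) θ' hnf hg.ren hleg
      (by
        rintro rfl
        have : r.tm g = Tm.top := by rw [← hgt]; exact (Tm.subst_fvar _).symm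
        cases g <;> simp_all [Ren.tm, Tm.ren, Tm.isAtom]) hgt
    rw [hprog] at this
    exact this
  case backchain i P g xs G Ar hg hr hcl hf₂ hnd hl hfl heq =>
    simp only at hprog hgoal
    have hsub := St.fvars_subset_of_mem_elabProg (s := ⟨i, P, g⟩) hcl
    rw [Tm.fvars_alls] at hsub
    have hcl' := r.tm_mem_elabProg hcl
    rw [Ren.tm, Tm.ren_alls] at hcl'
    have hG := hinst xs G (Finset.subset_union_left.trans hsub)
    have hAr := hinst xs Ar (Finset.subset_union_right.trans hsub)
    have := Loc.backchain (flat := flat) i (P.image r.tm) (r.tm g) xs (r.tm G) (r.tm Ar)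
      (ws.map r.vr) θ' hg.ren hr.ren hcl' (hws hf₂) (hnd.map r.vr.injective) hleg hflat
      (by rw [hgoal, hAr, heq])
    rw [hprog, hG] at this
    exact this
  case ax i P g xs Ar hg hr ha hcl hf₂ hnd hl hfl heq =>
    simp only at hprog hgoal
    have hsub := St.fvars_subset_of_mem_elabProg (s := ⟨i, P, g⟩) hcl
    rw [Tm.fvars_alls] at hsub
    have hcl' := r.tm_mem_elabProg hcl
    rw [Ren.tm, Tm.ren_alls] at hcl'
    exact Loc.ax (flat := flat) i (P.image r.tm) (r.tm g) xs (r.tm Ar)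
      (ws.map r.vr) θ' hg.ren hr.ren ha.ren hcl' (hws hf₂) (hnd.map r.vr.injective) hleg hflat
      (by rw [hgoal, hinst xs Ar hsub, heq])
  all_goals
    obtain ⟨rfl, rfl⟩ := hid rfl
  case null => exact Loc.null _ _
  case orl => exact Loc.orl _ _ _ _
  case orr => exact Loc.orr _ _ _ _
  case and => exact Loc.and _ _ _ _
  case inst i P x a g t h₁ h₂ h₃ h₄ =>
    have := Loc.inst (flat := flat) i (P.image r.tm) x a (r.tm g) (r.tm t) (r.pos_tm h₁)
      (r.wt_tm h₂) ((r.tyOf_tm t).trans h₃) ((r.lvl_tm t).le.trans h₄)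
    rw [Ren.tm, Ren.tm, ← Tm.ren_inst] at this
    exact this
  case augment i P d g =>
    have := Loc.augment (flat := flat) i (P.image r.tm) (r.tm d) (r.tm g)
    rw [← Finset.image_insert] at this
    exact this
  case generic i P x a g c h₁ h₂ =>
    have := Loc.generic (flat := flat) i (P.image r.tm) x a (r.tm g) (r.cs c)
      ((r.cs_lvl c).trans h₁) ((r.cs_ty c).trans h₂)
    rw [Ren.tm, show Tm.cst (r.cs c) = (Tm.cst c).ren r.vr r.cs from rfl, ← Tm.ren_inst] at this
    exact this

end Loc

/-- A resolution step without its freshness conditions, exposing the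
variables and constants that have to be fresh. -/
def PreStep (flat : Prop) (A : List St) (ws : List Vr) (cs : List Cs) (θ : Subst)
    (C : List St) : Prop :=
  ∃ (L : List St) (s : St) (R l : List St), A = L ++ s :: R ∧
    C = svSub θ L ++ (l ++ svSub θ R) ∧ Loc flat s ws cs θ l

/-- The freshness conditions of a resolution step. -/
def FreshFor (A : List St) (ws : List Vr) (cs : List Cs) : Prop :=
  (∀ w ∈ ws, w ∉ svFvars A) ∧ ∀ c ∈ cs, c ∉ svCsts A

theorem Step.exists_preStep {A C : List St} {θ : Subst} (h : Step A θ C) :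
    ∃ ws cs, PreStep False A ws cs θ C ∧ FreshFor A ws cs := by
  cases h
  case null L R i P =>
    exact ⟨_, _, ⟨L, _, R, _, rfl, by simp [svSub_id], Loc.null i P⟩, by simp [FreshFor]⟩
  case tru L R i P g h₁ h₂ h₃ h₄ =>
    exact ⟨_, _, ⟨L, _, R, _, rfl, by simp, Loc.tru i P g θ id h₁ h₂ h₃ h₄⟩, by simp [FreshFor]⟩
  case backchain L R i P g xs G Ar ws h₁ h₂ h₃ h₄ h₅ h₆ h₇ h₈ =>
    exact ⟨_, _, ⟨L, _, R, _, rfl, by simp,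
      Loc.backchain i P g xs G Ar ws θ h₁ h₂ h₃ h₄ h₅ h₇ False.elim h₈⟩, h₆, by simp⟩
  case ax L R i P g xs Ar ws h₁ h₂ h₃ h₄ h₅ h₆ h₇ h₈ h₉ =>
    exact ⟨_, _, ⟨L, _, R, _, rfl, by simp,
      Loc.ax i P g xs Ar ws θ h₁ h₂ h₃ h₄ h₅ h₆ h₈ False.elim h₉⟩, h₇, by simp⟩
  case orl L R i P g₁ g₂ =>
    exact ⟨_, _, ⟨L, _, R, _, rfl, by simp [svSub_id], Loc.orl i P g₁ g₂⟩, by simp [FreshFor]⟩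
  case orr L R i P g₁ g₂ =>
    exact ⟨_, _, ⟨L, _, R, _, rfl, by simp [svSub_id], Loc.orr i P g₁ g₂⟩, by simp [FreshFor]⟩
  case and L R i P g₁ g₂ =>
    exact ⟨_, _, ⟨L, _, R, _, rfl, by simp [svSub_id], Loc.and i P g₁ g₂⟩, by simp [FreshFor]⟩
  case inst L R i P x a g t h₁ h₂ h₃ h₄ =>
    exact ⟨_, _, ⟨L, _, R, _, rfl, by simp [svSub_id], Loc.inst i P x a g t h₁ h₂ h₃ h₄⟩,
      by simp [FreshFor]⟩
  case augment L R i P d g =>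
    exact ⟨_, _, ⟨L, _, R, _, rfl, by simp [svSub_id], Loc.augment i P d g⟩, by simp [FreshFor]⟩
  case generic L R i P x a g c h₁ h₂ h₃ =>
    exact ⟨_, _, ⟨L, _, R, _, rfl, by simp [svSub_id], Loc.generic i P x a g c h₁ h₂⟩,
      by simp, by simpa using h₃⟩

theorem FlatStep.exists_preStep {A C : List St} {θ : Subst} (h : FlatStep A θ C) :
    ∃ ws cs, PreStep True A ws cs θ C ∧ FreshFor A ws cs := by
  cases h
  case null L R i P =>
    exact ⟨_, _, ⟨L, _, R, _, rfl, by simp [svSub_id], Loc.null i P⟩, by simp [FreshFor]⟩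
  case backchain L R i P g xs G Ar ws h₁ h₂ h₃ h₄ h₅ h₆ h₇ h₈ h₉ h₀ =>
    exact ⟨_, _, ⟨L, _, R, _, rfl, by simp,
      Loc.backchain i P g xs G Ar ws θ h₁ h₂ h₃ h₄ h₅ h₇ (fun _ => ⟨h₈, h₉⟩) h₀⟩, h₆, by simp⟩
  case ax L R i P g xs Ar ws h₁ h₂ h₃ h₄ h₅ h₆ h₇ h₈ h₉ h₀ h =>
    exact ⟨_, _, ⟨L, _, R, _, rfl, by simp,
      Loc.ax i P g xs Ar ws θ h₁ h₂ h₃ h₄ h₅ h₆ h₈ (fun _ => ⟨h₉, h₀⟩) h⟩, h₇, by simp⟩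
  case orl L R i P g₁ g₂ =>
    exact ⟨_, _, ⟨L, _, R, _, rfl, by simp [svSub_id], Loc.orl i P g₁ g₂⟩, by simp [FreshFor]⟩
  case orr L R i P g₁ g₂ =>
    exact ⟨_, _, ⟨L, _, R, _, rfl, by simp [svSub_id], Loc.orr i P g₁ g₂⟩, by simp [FreshFor]⟩
  case and L R i P g₁ g₂ =>
    exact ⟨_, _, ⟨L, _, R, _, rfl, by simp [svSub_id], Loc.and i P g₁ g₂⟩, by simp [FreshFor]⟩
  case inst L R i P x a g t h₁ h₂ h₃ h₄ =>
    exact ⟨_, _, ⟨L, _, R, _, rfl, by simp [svSub_id], Loc.inst i P x a g t h₁ h₂ h₃ h₄⟩,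
      by simp [FreshFor]⟩
  case augment L R i P d g =>
    exact ⟨_, _, ⟨L, _, R, _, rfl, by simp [svSub_id], Loc.augment i P d g⟩, by simp [FreshFor]⟩
  case generic L R i P x a g c h₁ h₂ h₃ =>
    exact ⟨_, _, ⟨L, _, R, _, rfl, by simp [svSub_id], Loc.generic i P x a g c h₁ h₂⟩,
      by simp, by simpa using h₃⟩

namespace PreStep

variable {flat : Prop} {A C : List St} {ws : List Vr} {cs : List Cs} {θ : Subst}

theorem toStep (h : PreStep False A ws cs θ C) (hf : FreshFor A ws cs) : Step A θ C := by
  obtain ⟨L, s, R, l, rfl, rfl, h⟩ := h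
  obtain ⟨hv, hc⟩ := hf
  cases h <;> simp only [svSub_id, List.nil_append, List.cons_append]
  case null => exact Step.null _ _ _ _
  case tru => exact Step.tru _ _ _ _ _ _ ‹_› ‹_› ‹_› ‹_›
  case backchain => exact Step.backchain _ _ _ _ _ _ _ _ _ _ ‹_› ‹_› ‹_› ‹_› ‹_› hv ‹_› ‹_›
  case ax => exact Step.ax _ _ _ _ _ _ _ _ _ ‹_› ‹_› ‹_› ‹_› ‹_› ‹_› hv ‹_› ‹_›
  case orl => exact Step.orl _ _ _ _ _ _
  case orr => exact Step.orr _ _ _ _ _ _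
  case and => exact Step.and _ _ _ _ _ _
  case inst => exact Step.inst _ _ _ _ _ _ _ _ ‹_› ‹_› ‹_› ‹_›
  case augment => exact Step.augment _ _ _ _ _ _
  case generic => exact Step.generic _ _ _ _ _ _ _ _ ‹_› ‹_› (hc _ (by simp))

theorem toFlatStep (h : PreStep True A ws cs θ C) (hf : FreshFor A ws cs) : FlatStep A θ C := by
  obtain ⟨L, s, R, l, rfl, rfl, h⟩ := h
  obtain ⟨hv, hc⟩ := hf
  have hd := h.safe_and_dom trivial
  cases h <;> simp only [svSub_id, List.nil_append, List.cons_append]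
  case null => exact FlatStep.null _ _ _ _
  case tru => exact absurd trivial ‹¬ True›
  case backchain =>
    exact FlatStep.backchain _ _ _ _ _ _ _ _ _ _ ‹_› ‹_› ‹_› ‹_› ‹_› hv ‹_› hd.1 hd.2 ‹_›
  case ax => exact FlatStep.ax _ _ _ _ _ _ _ _ _ ‹_› ‹_› ‹_› ‹_› ‹_› ‹_› hv ‹_› hd.1 hd.2 ‹_›
  case orl => exact FlatStep.orl _ _ _ _ _ _
  case orr => exact FlatStep.orr _ _ _ _ _ _
  case and => exact FlatStep.and _ _ _ _ _ _
  case inst => exact FlatStep.inst _ _ _ _ _ _ _ _ ‹_› ‹_› ‹_› ‹_›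
  case augment => exact FlatStep.augment _ _ _ _ _ _
  case generic => exact FlatStep.generic _ _ _ _ _ _ _ _ ‹_› ‹_› (hc _ (by simp))

theorem legal (h : PreStep flat A ws cs θ C) : θ.legal := by
  obtain ⟨L, s, R, l, rfl, rfl, h⟩ := h
  exact h.legal

theorem safe_and_dom (h : PreStep flat A ws cs θ C) (hf : flat) :
    θ.safe ∧ ∀ v : Vr, θ.f v ≠ Tm.fvar v → v ∈ ws := by
  obtain ⟨L, s, R, l, rfl, rfl, h⟩ := h
  exact h.safe_and_dom hf

theorem twist (h : PreStep flat A ws cs θ C) {r r' : Ren} (hcs : r.cs = r'.cs) {θ' : Subst}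
    (hag : ∀ v, v ∈ svFvars A ∨ v ∈ ws → θ'.f (r.vr v) = r'.tm (θ.f v))
    (hleg : θ'.legal) (hid : θ = Subst.id → r = r' ∧ θ' = Subst.id)
    (hflat : flat → θ'.safe ∧ ∀ v : Vr, θ'.f v ≠ Tm.fvar v → v ∈ ws.map r.vr) :
    PreStep flat (r.sv A) (ws.map r.vr) (cs.map r.cs) θ' (r'.sv C) := by
  obtain ⟨L, s, R, l, rfl, rfl, h⟩ := h
  have hs : ∀ s' ∈ L ++ s :: R, ∀ v ∈ s'.fvars, θ'.f (r.vr v) = r'.tm (θ.f v) :=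
    fun s' hs' v hv => hag v (Or.inl (mem_svFvars.2 ⟨s', hs', hv⟩))
  refine ⟨r.sv L, r.st s, r.sv R, r'.sv l, by simp [Ren.sv], ?_, h.twist hcs ?_ hleg hid hflat⟩
  · rw [Ren.sv_append, Ren.sv_append, svSub_ren hcs, svSub_ren hcs]
    all_goals
      intro v hv
      obtain ⟨s', hs', hv⟩ := mem_svFvars.1 hv
      exact hs s' (by simp [hs']) v hv
  · rintro v (hv | hv)
    · exact hs s (by simp) v hv
    · exact hag v (Or.inr hv)

theorem conj (h : PreStep flat A ws cs θ C) (r : Ren) :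
    PreStep flat (r.sv A) (ws.map r.vr) (cs.map r.cs) (Subst.conj r θ) (r.sv C) := by
  refine h.twist rfl (fun v _ => Subst.conj_apply r θ v) (h.legal.conj r)
    (fun hθ => ⟨rfl, by rw [hθ, Subst.conj_id]⟩) fun hf => ⟨(h.safe_and_dom hf).1.conj r, ?_⟩
  intro v hv
  exact List.mem_map.2 ⟨_, (h.safe_and_dom hf).2 _ (Subst.conj_ne hv), by simp⟩

theorem append (h : PreStep flat A ws cs θ C) {B : List St}
    (hB : ∀ v ∈ svFvars B, θ.f v = Tm.fvar v) : PreStep flat (A ++ B) ws cs θ (C ++ B) := by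
  obtain ⟨L, s, R, l, rfl, rfl, h⟩ := h
  exact ⟨L, s, R ++ B, l, by simp, by simp [svSub_append, svSub_eq_self hB], h⟩

end PreStep

theorem FreshFor.sv {A : List St} {ws : List Vr} {cs : List Cs} (h : FreshFor A ws cs) (r : Ren) :
    FreshFor (r.sv A) (ws.map r.vr) (cs.map r.cs) := by
  constructor
  · intro w hw hA
    obtain ⟨u, hu, rfl⟩ := List.mem_map.1 hw
    obtain ⟨v, hv, hvu⟩ := r.mem_svFvars_sv.1 hA
    exact h.1 u hu (r.vr.injective hvu ▸ hv)
  · intro w hw hA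
    obtain ⟨u, hu, rfl⟩ := List.mem_map.1 hw
    obtain ⟨v, hv, hvu⟩ := r.mem_svCsts_sv.1 hA
    exact h.2 u hu (r.cs.injective hvu ▸ hv)

theorem FreshFor.append {A B : List St} {ws : List Vr} {cs : List Cs} (hA : FreshFor A ws cs)
    (hB : FreshFor B ws cs) : FreshFor (A ++ B) ws cs := by
  constructor
  · intro w hw h
    exact (mem_svFvars_append.1 h).elim (hA.1 w hw) (hB.1 w hw)
  · intro c hc h
    exact (mem_svCsts_append.1 h).elim (hA.2 c hc) (hB.2 c hc)

/-- Resolution derivations, flat or not, with their composed substitution. -/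
inductive PreDeriv (flat : Prop) : List St → Subst → List St → ℕ → Prop
  | refl (A : List St) : PreDeriv flat A Subst.id A 0
  | step {A B C : List St} {ws : List Vr} {cs : List Cs} {σ τ : Subst} {n : ℕ} :
      PreStep flat A ws cs σ B → FreshFor A ws cs → PreDeriv flat B τ C n →
      PreDeriv flat A (σ.comp τ) C (n + 1)

theorem Deriv.toPreDeriv {A C : List St} {σ : Subst} {n : ℕ} (h : Deriv A σ C n) :
    PreDeriv False A σ C n := by
  induction h with
  | refl A => exact .refl A
  | step h _ ih =>
    obtain ⟨ws, cs, h, hf⟩ := h.exists_preStep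
    exact .step h hf ih

theorem FlatDeriv.exists_preDeriv {A C : List St} {n : ℕ} (h : FlatDeriv A C n) :
    ∃ σ, PreDeriv True A σ C n := by
  induction h with
  | refl A => exact ⟨_, .refl A⟩
  | step h _ ih =>
    obtain ⟨ws, cs, h, hf⟩ := h.exists_preStep
    obtain ⟨σ, ih⟩ := ih
    exact ⟨_, .step h hf ih⟩

namespace PreDeriv

variable {flat : Prop} {A B C : List St} {σ τ : Subst} {m n : ℕ}

theorem toDeriv (h : PreDeriv False A σ C n) : Deriv A σ C n := by
  induction h with
  | refl A => exact .refl A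
  | step h hf _ ih => exact .step (h.toStep hf) ih

theorem toFlatDeriv (h : PreDeriv True A σ C n) : FlatDeriv A C n := by
  induction h with
  | refl A => exact .refl A
  | step h hf _ ih => exact .step (h.toFlatStep hf) ih

theorem trans (h : PreDeriv flat A σ B m) (h' : PreDeriv flat B τ C n) :
    ∃ k, PreDeriv flat A (σ.comp τ) C k := by
  induction h with
  | refl A => exact ⟨n, by rwa [Subst.id_comp]⟩
  | step h hf _ ih =>
    obtain ⟨k, ih⟩ := ih h'
    exact ⟨k + 1, by rw [Subst.comp_assoc]; exact .step h hf ih⟩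

theorem conj (h : PreDeriv flat A σ C n) (r : Ren) :
    PreDeriv flat (r.sv A) (Subst.conj r σ) (r.sv C) n := by
  induction h with
  | refl A => rw [Subst.conj_id]; exact .refl _
  | step h hf _ ih => rw [Subst.conj_comp]; exact .step (h.conj r) (hf.sv r) ih

theorem lvl_le_and_ty_eq (h : PreDeriv flat A σ C n) {u v : Vr} (hv : σ.f v = Tm.fvar u) :
    u.lvl ≤ v.lvl ∧ u.ty = v.ty := by
  induction h generalizing v with
  | refl A => obtain rfl : v = u := Tm.fvar.inj hv; simp
  | step h _ _ ih =>
    obtain ⟨w, hw⟩ := Tm.eq_fvar_of_subst_eq_fvar hv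
    simp only [Subst.comp, hw] at hv
    have h₁ := ih hv
    have h₂ := h.legal v
    rw [hw] at h₂
    exact ⟨h₁.1.trans h₂.2.2.2, h₁.2.trans h₂.2.2.1⟩

end PreDeriv

theorem exists_perm_extending {α β : Type*} [DecidableEq α] (f : α → β) (F : Finset α) (h : α → α)
    (hinj : Set.InjOn h F) (hf : ∀ a ∈ F, f (h a) = f a) :
    ∃ e : Equiv.Perm α, (∀ a, f (e a) = f a) ∧ ∀ a ∈ F, e a = h a := by
  induction F using Finset.induction_on with
  | empty => exact ⟨1, by simp, by simp⟩
  | insert a F ha ih =>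
    obtain ⟨e, he, heF⟩ := ih (hinj.mono (by simp)) fun b hb => hf b (Finset.mem_insert_of_mem hb)
    have hfa : f (h a) = f (e a) := (hf a (Finset.mem_insert_self _ _)).trans (he a).symm
    refine ⟨e.trans (Equiv.swap (e a) (h a)), fun b => ?_, fun b hb => ?_⟩
    · rw [Equiv.trans_apply, Equiv.swap_apply_def, ← he b]
      split_ifs <;> simp_all
    · rcases Finset.mem_insert.1 hb with rfl | hb
      · simp
      · have hne : b ≠ a := fun h => ha (h ▸ hb)
        rw [Equiv.trans_apply, Equiv.swap_apply_of_ne_of_ne (fun h' => hne (e.injective h')),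
          heF b hb]
        rw [heF b hb]
        exact fun h' => hne (hinj (by simp [hb]) (by simp) h')

theorem Vr.exists_shift (S : Finset Vr) : ∃ k : Vr → Vr, k.Injective ∧
    (∀ v, ((k v).lvl, (k v).ty) = (v.lvl, v.ty)) ∧ ∀ v, k v ∉ S := by
  refine ⟨fun v => ⟨v.name + (S.sup Vr.name + 1), v.lvl, v.ty⟩, ?_, fun _ => rfl, fun v hv => ?_⟩
  · rintro ⟨_, _, _⟩ ⟨_, _, _⟩ h
    simpa using h
  · have := Finset.le_sup (f := Vr.name) hv
    simp only at this
    omega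

theorem Cs.exists_shift (S : Finset Cs) : ∃ k : Cs → Cs, k.Injective ∧
    (∀ v, ((k v).lvl, (k v).ty) = (v.lvl, v.ty)) ∧ ∀ v, k v ∉ S := by
  refine ⟨fun v => ⟨v.name + (S.sup Cs.name + 1), v.lvl, v.ty⟩, ?_, fun _ => rfl, fun v hv => ?_⟩
  · rintro ⟨_, _, _⟩ ⟨_, _, _⟩ h
    simpa using h
  · have := Finset.le_sup (f := Cs.name) hv
    simp only at this
    omega

theorem exists_perm_avoiding {α β : Type*} [DecidableEq α] (f : α → β)
    (hshift : ∀ S : Finset α, ∃ k : α → α, k.Injective ∧ (∀ a, f (k a) = f a) ∧ ∀ a, k a ∉ S)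
    (V W S : Finset α) :
    ∃ e : Equiv.Perm α, (∀ a, f (e a) = f a) ∧ (∀ a ∈ V, e a = a) ∧
      ∀ a ∈ W, a ∉ V → e a ∉ S := by
  obtain ⟨k, hk, hkf, hkS⟩ := hshift (V ∪ S)
  obtain ⟨e, he, heF⟩ := exists_perm_extending f (V ∪ W) (fun a => if a ∈ V then a else k a)
    (by
      intro a _ b _ h
      have ha := hkS a
      have hb := hkS b
      simp only [Finset.mem_union, not_or] at ha hb
      simp only at h
      split_ifs at h with h₁ h₂ h₂
      · exact h
      · exact absurd (h ▸ h₁) hb.1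
      · exact absurd (h ▸ h₂) ha.1
      · exact hk h)
    (by intro a _; split_ifs; exacts [rfl, hkf a])
  refine ⟨e, he, fun a ha => ?_, fun a ha haV h => ?_⟩
  · rw [heF a (by simp [ha]), if_pos ha]
  · rw [heF a (by simp [ha]), if_neg haV] at h
    exact hkS a (by simp [h])

/-- The fresh variables and constants of a step, as well as the variables it
introduces, can be renamed away from given finite sets. -/
theorem PreStep.exists_conj_fresh {flat : Prop} {A C : List St} {ws : List Vr} {cs : List Cs}
    {θ : Subst} (h : PreStep flat A ws cs θ C) (hf : FreshFor A ws cs)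
    (S : Finset Vr) (K : Finset Cs) :
    ∃ r : Ren, (∀ v ∈ svFvars A, r.vr v = v) ∧
      PreStep flat A (ws.map r.vr) (cs.map r.cs) (Subst.conj r θ) (r.sv C) ∧
      FreshFor A (ws.map r.vr) (cs.map r.cs) ∧
      (∀ w ∈ ws.map r.vr, w ∉ S) ∧ (∀ c ∈ cs.map r.cs, c ∉ K) ∧
      ∀ v ∈ svFvars (r.sv C), v ∈ S → v ∈ svFvars A := by
  obtain ⟨e, he, heA, heS⟩ := exists_perm_avoiding (fun v : Vr => (v.lvl, v.ty)) Vr.exists_shift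
    (svFvars A) (ws.toFinset ∪ svFvars C) S
  obtain ⟨d, hd, hdA, hdK⟩ := exists_perm_avoiding (fun c : Cs => (c.lvl, c.ty)) Cs.exists_shift
    (svCsts A) cs.toFinset K
  simp only [Prod.mk.injEq] at he hd
  let r : Ren := ⟨e, d, fun v => (he v).1, fun v => (he v).2, fun c => (hd c).1, fun c => (hd c).2⟩
  have hA : r.sv A = A := r.sv_eq_self heA hdA
  have h' := h.conj r
  have hf' := hf.sv r
  rw [hA] at h' hf'
  refine ⟨r, heA, h', hf', fun w hw => ?_, fun c hc => ?_, fun v hv hS => ?_⟩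
  · obtain ⟨u, hu, rfl⟩ := List.mem_map.1 hw
    exact heS u (by simp [hu]) (hf.1 u hu)
  · obtain ⟨u, hu, rfl⟩ := List.mem_map.1 hc
    exact hdK u (by simp [hu]) (hf.2 u hu)
  · obtain ⟨u, hu, rfl⟩ := r.mem_svFvars_sv.1 hv
    by_cases huA : u ∈ svFvars A
    · rwa [show r.vr u = u from heA u huA]
    · exact absurd hS (heS u (by simp [hu]) huA)

theorem PreDeriv.append_of_flat {A : List St} {σ : Subst} {n : ℕ} (h : PreDeriv True A σ [] n)
    (B : List St) : ∃ σ', PreDeriv True (A ++ B) σ' B n := by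
  induction n generalizing A σ with
  | zero => cases h; exact ⟨_, .refl B⟩
  | succ n ih =>
    cases h with
    | step h hf hd =>
      obtain ⟨r, -, h', hf', hS, hK, -⟩ := h.exists_conj_fresh hf (svFvars B) (svCsts B)
      obtain ⟨σ', ih⟩ := ih (hd.conj r)
      refine ⟨_, .step (h'.append fun v hv => ?_) (hf'.append ⟨hS, hK⟩) ih⟩
      by_contra hne
      exact hS v ((h'.safe_and_dom trivial).2 v hne) hv

/-- The substitution acts on the given variables as an injective,
level-preserving renaming. -/
def Subst.RenamesOn (σ : Subst) (T : Set Vr) : Prop :=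
  ∃ u : Vr → Vr, Set.InjOn u T ∧ ∀ v ∈ T, σ.f v = Tm.fvar (u v) ∧ (u v).lvl = v.lvl

/-- A step whose substitution restricts to an injective renaming `k` of the
protected variables `S` of the source can be twisted by a renaming of its
target so as to fix `S`. -/
theorem PreStep.exists_twist_fixing {A C : List St} {ws : List Vr} {cs : List Cs}
    {θ : Subst} (h : PreStep False A ws cs θ C) {S : Finset Vr} (hws : ∀ w ∈ ws, w ∉ S)
    (hC : ∀ v ∈ svFvars C, v ∈ S → v ∈ svFvars A) {k : Vr → Vr}
    (hk : ∀ v ∈ S, v ∈ svFvars A → θ.f v = Tm.fvar (k v) ∧ (k v).lvl = v.lvl)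
    (hinj : ∀ v ∈ S, v ∈ svFvars A → ∀ w ∈ S, w ∈ svFvars A → k v = k w → v = w) :
    ∃ (r : Ren) (θ' : Subst), PreStep False A ws cs θ' (r.sv C) ∧
      (∀ v ∈ S, θ'.f v = Tm.fvar v) ∧
      ∀ v ∈ svFvars C, r.vr v ∈ S → r.vr v ∈ svFvars A ∧ k (r.vr v) = v := by
  classical
  by_cases hid : θ = Subst.id
  · subst hid
    refine ⟨Ren.one, Subst.id, by rwa [Ren.sv_one], fun _ _ => rfl, fun v hv hS => ?_⟩
    have hvA := hC v hv hS
    exact ⟨hvA, (Tm.fvar.inj (hk v hS hvA).1).symm⟩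
  set T := S ∩ svFvars A with hT
  have hkT : ∀ t ∈ T, θ.f t = Tm.fvar (k t) ∧ (k t).lvl = t.lvl := fun t ht =>
    hk t (Finset.mem_inter.1 ht).1 (Finset.mem_inter.1 ht).2
  have hinjT : Set.InjOn k T := fun v hv w hw => by
    have hv := Finset.mem_inter.1 (Finset.mem_coe.1 hv)
    have hw := Finset.mem_inter.1 (Finset.mem_coe.1 hw)
    exact hinj v hv.1 hv.2 w hw.1 hw.2
  obtain ⟨g, hg, hgc, hgS⟩ := Vr.exists_shift S
  let p : Vr → Vr := fun v => if hv : ∃ t ∈ T, k t = v then hv.choose else g v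
  have hpk : ∀ t ∈ T, p (k t) = t := fun t ht => by
    have hex : ∃ t' ∈ T, k t' = k t := ⟨t, ht, rfl⟩
    simp only [p, dif_pos hex]
    exact hinjT hex.choose_spec.1 ht hex.choose_spec.2
  have hpg : ∀ v, (¬ ∃ t ∈ T, k t = v) → p v = g v := fun v hv => dif_neg hv
  obtain ⟨e, he, hep⟩ := exists_perm_extending (fun v : Vr => (v.lvl, v.ty))
    (svFvars C ∪ T.image k) p
    (by
      intro v _ w _ hvw
      by_cases hv : ∃ t ∈ T, k t = v <;> by_cases hw : ∃ t ∈ T, k t = w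
      · obtain ⟨t, ht, rfl⟩ := hv
        obtain ⟨t', ht', rfl⟩ := hw
        rw [hpk t ht, hpk t' ht'] at hvw
        rw [hvw]
      · obtain ⟨t, ht, rfl⟩ := hv
        rw [hpk t ht, hpg w hw] at hvw
        exact absurd (hvw ▸ (Finset.mem_inter.1 ht).1) (hgS w)
      · obtain ⟨t, ht, rfl⟩ := hw
        rw [hpk t ht, hpg v hv] at hvw
        exact absurd (hvw.symm ▸ (Finset.mem_inter.1 ht).1) (hgS v)
      · rw [hpg v hv, hpg w hw] at hvw
        exact hg hvw)
    (by
      intro v _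
      by_cases hv : ∃ t ∈ T, k t = v
      · obtain ⟨t, ht, rfl⟩ := hv
        have hty := (h.legal t).2.2.1
        rw [(hkT t ht).1] at hty
        rw [hpk t ht]
        exact Prod.ext (hkT t ht).2.symm hty.symm
      · rw [hpg v hv]
        exact hgc v)
  simp only [Prod.mk.injEq] at he
  let r : Ren := ⟨e, 1, fun v => (he v).1, fun v => (he v).2, fun _ => rfl, fun _ => rfl⟩
  let θ' : Subst :=
    ⟨fun v => if v ∈ (svFvars A ∪ ws.toFinset) \ S then r.tm (θ.f v) else Tm.fvar v, by
      refine ((svFvars A ∪ ws.toFinset) \ S).finite_toSet.subset fun v hv => ?_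
      by_contra hv'
      exact hv (if_neg hv')⟩
  have hleg : θ'.legal := by
    intro v
    obtain ⟨h₁, h₂, h₃, h₄⟩ := h.legal v
    simp only [θ']
    split_ifs
    · exact ⟨r.pos_tm h₁, r.wt_tm h₂, (r.tyOf_tm _).trans h₃, (r.lvl_tm _).le.trans h₄⟩
    · exact Subst.legal_id v
  have hag : ∀ v, v ∈ svFvars A ∨ v ∈ ws → θ'.f (Ren.one.vr v) = r.tm (θ.f v) := by
    intro v hv
    change θ'.f v = _
    by_cases hvS : v ∈ S
    · have hvA : v ∈ svFvars A := hv.resolve_right fun hw => hws v hw hvS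
      have hvT : v ∈ T := Finset.mem_inter.2 ⟨hvS, hvA⟩
      have hev : e (k v) = v := by
        rw [hep _ (Finset.mem_union_right _ (Finset.mem_image_of_mem k hvT)), hpk v hvT]
      rw [(hkT v hvT).1]
      simp [θ', hvS, Ren.tm, Tm.ren, r, hev]
    · simp [θ', hvS, hv]
  refine ⟨r, θ', ?_, fun v hv => ?_, fun v hv hS => ?_⟩
  · have := h.twist (r := Ren.one) (r' := r) rfl hag hleg (fun h' => absurd h' hid) False.elim
    rw [Ren.sv_one] at this
    simpa [Ren.one] using this
  · simp [θ', hv]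
  · have hev : r.vr v = p v := hep v (Finset.mem_union_left _ hv)
    by_cases hvT : ∃ t ∈ T, k t = v
    · obtain ⟨t, ht, rfl⟩ := hvT
      rw [hev, hpk t ht]
      exact ⟨(Finset.mem_inter.1 ht).2, rfl⟩
    · rw [hev, hpg v hvT] at hS
      exact absurd hS (hgS v)

/-- A successful derivation acting as a renaming on the protected variables
`S` occurring in it can be carried out next to any state vector with
variables in `S`, fixing `S`. -/
theorem PreDeriv.append_fixing {A : List St} {σ : Subst} {n : ℕ} (h : PreDeriv False A σ [] n)
    {S : Finset Vr} (hσ : σ.RenamesOn {v | v ∈ S ∧ v ∈ svFvars A})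
    {B : List St} (hB : svFvars B ⊆ S) :
    ∃ σ', PreDeriv False (A ++ B) σ' B n ∧ ∀ v ∈ S, σ'.f v = Tm.fvar v := by
  induction n generalizing A σ with
  | zero => cases h; exact ⟨_, .refl B, fun _ _ => rfl⟩
  | succ n ih =>
    cases h with
    | @step _ C _ ws cs θ τ _ h hf hd =>
      obtain ⟨r, hrA, h, hf, hws, hcs, hC⟩ := h.exists_conj_fresh hf S (svCsts B)
      replace hd := hd.conj r
      obtain ⟨u, hu, huσ⟩ := hσ
      replace huσ : ∀ v, v ∈ S ∧ v ∈ svFvars A → ∃ w, (Subst.conj r θ).f v = Tm.fvar w ∧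
          (Subst.conj r τ).f w = Tm.fvar (r.vr (u v)) ∧ (u v).lvl = v.lvl := by
        intro v hv
        obtain ⟨h₁, h₂⟩ := huσ v hv
        have h₃ : ((Subst.conj r θ).comp (Subst.conj r τ)).f v = Tm.fvar (r.vr (u v)) := by
          have := Subst.conj_apply r (θ.comp τ) v
          rw [hrA v hv.2, h₁, Subst.conj_comp] at this
          exact this
        obtain ⟨w, hw⟩ := Tm.eq_fvar_of_subst_eq_fvar h₃
        simp only [Subst.comp, hw] at h₃
        exact ⟨w, hw, h₃, h₂⟩
      choose! k hkθ hkτ hkl using huσ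
      obtain ⟨r', θ', h', hθ', hC'⟩ := h.exists_twist_fixing (S := S) (k := k) hws hC
        (by
          refine fun v hS hA => ⟨hkθ v ⟨hS, hA⟩, le_antisymm ?_ ?_⟩
          · have := (h.legal v).2.2.2
            rwa [hkθ v ⟨hS, hA⟩] at this
          · have := (hd.lvl_le_and_ty_eq (hkτ v ⟨hS, hA⟩)).1
            rwa [r.vr_lvl, hkl v ⟨hS, hA⟩] at this)
        (by
          intro v hS hA w hS' hA' hvw
          have h₁ := hkτ v ⟨hS, hA⟩
          rw [hvw, hkτ w ⟨hS', hA'⟩] at h₁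
          exact hu ⟨hS, hA⟩ ⟨hS', hA'⟩ (r.vr.injective (Tm.fvar.inj h₁).symm))
      have key : ∀ v, v ∈ S ∧ v ∈ svFvars (r'.sv (r.sv C)) →
          v ∈ svFvars A ∧ r'.vr (k v) = v := by
        rintro v ⟨hS, hv⟩
        obtain ⟨w, hw, rfl⟩ := r'.mem_svFvars_sv.1 hv
        obtain ⟨h₁, h₂⟩ := hC' w hw hS
        exact ⟨h₁, by rw [h₂]⟩
      obtain ⟨σ', hd', hσ'⟩ := ih (hd.conj r') ⟨fun v => r'.vr (r.vr (u v)),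
        fun v hv w hw hvw => hu ⟨hv.1, (key v hv).1⟩ ⟨hw.1, (key w hw).1⟩
          (r.vr.injective (r'.vr.injective hvw)),
        fun v hv => by
          obtain ⟨hA, hr'⟩ := key v hv
          have := Subst.conj_apply r' (Subst.conj r τ) (k v)
          rw [hr', hkτ v ⟨hv.1, hA⟩] at this
          exact ⟨this, by rw [r'.vr_lvl, r.vr_lvl, hkl v ⟨hv.1, hA⟩]⟩⟩
      refine ⟨_, .step (h'.append fun v hv => hθ' v (hB hv))
        (hf.append ⟨fun w hw hwB => hws w hw (hB hwB), hcs⟩) hd', fun v hv => ?_⟩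
      simp only [Subst.comp, hθ' v hv, Tm.subst, hσ' v hv]

theorem resolves_id_iff {A C : List St} :
    Resolves A Subst.id C ↔
      ∃ n σ, PreDeriv False A σ C n ∧ ∀ v ∈ svFvars A, σ.f v = Tm.fvar v := by
  constructor
  · rintro ⟨n, σ, h, hσ⟩
    refine ⟨n, σ, h.toPreDeriv, fun v hv => ?_⟩
    have := congrFun (congrArg Subst.f hσ) v
    simpa [Subst.id, Subst.restrict, hv] using this.symm
  · rintro ⟨n, σ, h, hσ⟩
    refine ⟨n, σ, h.toDeriv, Subst.ext_f fun v => ?_⟩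
    by_cases hv : v ∈ svFvars A <;> simp [Subst.id, Subst.restrict, hv, hσ]

theorem Subst.RenamesOn.of_fixes {σ : Subst} {T : Set Vr} (h : ∀ v ∈ T, σ.f v = Tm.fvar v) :
    σ.RenamesOn T :=
  ⟨id, Set.injOn_id T, fun v hv => ⟨h v hv, rfl⟩⟩

/-- **Product lemma.**  If there are successful resolutions `𝔄 ⇝ … ⇝ □` and
`𝔅 ⇝ … ⇝ □`, each with identity computed answer, then there is a successful
resolution `𝔄 ⊗ 𝔅 ⇝ … ⇝ □` with identity computed answer; moreover the
resulting derivation may be taken flat whenever both given derivations are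
flat. -/
theorem product_lemma (A B : List St) (hwfA : svWf A) (hwfB : svWf B) :
    (Resolves A Subst.id [] → Resolves B Subst.id [] →
      Resolves (A ++ B) Subst.id []) ∧
    ((∃ n, FlatDeriv A [] n) → (∃ m, FlatDeriv B [] m) →
      ∃ k, FlatDeriv (A ++ B) [] k) := by
  constructor
  · intro hA hB
    obtain ⟨n, σ, hA, hσ⟩ := resolves_id_iff.1 hA
    obtain ⟨m, τ, hB, hτ⟩ := resolves_id_iff.1 hB
    obtain ⟨σ', hA, hσ'⟩ := hA.append_fixing (S := svFvars (A ++ B)) (B := B)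
      (.of_fixes fun v hv => hσ v hv.2) fun v hv => mem_svFvars_append.2 (Or.inr hv)
    obtain ⟨τ', hB, hτ'⟩ := hB.append_fixing (S := svFvars (A ++ B)) (B := [])
      (.of_fixes fun v hv => hτ v hv.2) (by simp [svFvars])
    rw [List.append_nil] at hB
    obtain ⟨k, h⟩ := hA.trans hB
    refine resolves_id_iff.2 ⟨k, _, h, fun v hv => ?_⟩
    simp only [Subst.comp, hσ' v hv, Tm.subst, hτ' v hv]
  · rintro ⟨n, hA⟩ ⟨m, hB⟩
    obtain ⟨σ, hA⟩ := hA.exists_preDeriv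
    obtain ⟨τ, hB⟩ := hB.exists_preDeriv
    obtain ⟨σ', hA⟩ := hA.append_of_flat B
    obtain ⟨k, h⟩ := hA.trans hB
    exact ⟨k, h.toFlatDeriv⟩
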